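/- Let k ≥ 2, let L be a type, and let m : (Fin (k+1) → L) → L be a near-unanimity operation. Call a subset S ⊆ L m-convex if for every v : Fin (k+1) → L such that v i ∈ S for all but at most one index i, one has m v ∈ S. If M₁, …, Mₙ are m-convex subsets of L and every intersection of at most k of them is nonempty, then M₁ ∩ … ∩ Mₙ is nonempty. -/

import Mathlib

/-- `m` is a near-unanimity operation of arity `k+1`. -/
def IsNUOp {L : Type*} {k : ℕ} (m : (Fin (k + 1) → L) → L) : Prop :=
  ∀ (a : L) (v : Fin (k + 1) → L), (∃ j, ∀ i ≠ j, v i = a) → m v = a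

/-- `S` is convex with respect to `m`. -/
def MConvex {L : Type*} {k : ℕ} (m : (Fin (k + 1) → L) → L) (S : Set L) : Prop :=
  ∀ v : Fin (k + 1) → L, (∃ j, ∀ i ≠ j, v i ∈ S) → m v ∈ S

/-- Helly property of `m`-convex sets: if any at most `k` members of a family indexed by `ι` have
a common point, then so do the members indexed by any finite set. -/
theorem MConvex.biInter_nonempty {L ι : Type*} {k : ℕ} {m : (Fin (k + 1) → L) → L} {M : ι → Set L}
    (hconv : ∀ i, MConvex m (M i))
    (hint : ∀ s : Finset ι, s.card ≤ k → (⋂ i ∈ s, M i).Nonempty) (s : Finset ι) :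
    (⋂ i ∈ s, M i).Nonempty := by
  classical
  induction s using Finset.strongInduction with
  | H s ih =>
    by_cases hs : s.card ≤ k
    · exact hint s hs
    obtain ⟨e⟩ : Nonempty (Fin (k + 1) ↪ s) :=
      Function.Embedding.nonempty_of_card_le (by simp; omega)
    choose x hx using fun j => ih (s.erase (e j)) (Finset.erase_ssubset (e j).2)
    simp only [Set.mem_iInter, Finset.mem_erase] at hx
    refine ⟨m x, Set.mem_iInter₂.2 fun i hi => hconv i x ?_⟩
    by_cases h : ∃ j, (e j : ι) = i
    · obtain ⟨j, rfl⟩ := h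
      exact ⟨j, fun l hl => hx l _ ⟨fun he => hl (e.injective (Subtype.ext he)).symm, hi⟩⟩
    · push Not at h
      exact ⟨0, fun l _ => hx l i ⟨(h l).symm, hi⟩⟩

/-- if every intersection of at most `k` of the `m`-convex sets
`M 1, …, M n` is nonempty, then their total intersection is nonempty. -/
theorem stmt8 {L : Type*} {k : ℕ} (hk : 2 ≤ k) (m : (Fin (k + 1) → L) → L)
    (hm : IsNUOp m) (n : ℕ) (M : Fin n → Set L) (hconv : ∀ i, MConvex m (M i))
    (hint : ∀ s : Finset (Fin n), s.card ≤ k → (⋂ i ∈ s, M i).Nonempty) :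
    (⋂ i, M i).Nonempty := by
  simpa using MConvex.biInter_nonempty hconv hint Finset.univ
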